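/- arXiv:1603.08766 — 3 statements merged into one kernel-verified Lean document; each statement's English description precedes it below -/
import Mathlib

section
/- Let ε1, ε2 > 0, q ≠ 0, R > 0, T > 0, let c1, c2 : [0,1] → ℝ be continuous, and let Q1, Q2, Pf1, Pf2 : [0,1]² → ℝ be continuous symmetric kernels. Suppose u*, v* ∈ C¹([0,1]×[0,T]) and U* ∈ C([0,T]) solve the state system, let λ1, λ2 ∈ C¹([0,1]×[0,T]) be arbitrary, and let (δu, δv, δU) be an admissible variation. Then the function ε ↦ J(u* + ε δu, v* + ε δv, U* + ε δU) is differentiable at ε = 0 and its derivative there equals: ∫₀ᵀ [⟨Q1(u*(·,t)), δu(·,t)⟩ + ⟨ε1 λ1_x(·,t) + c2(·) λ2(·,t) + λ1_t(·,t), δu(·,t)⟩] dt + ∫₀ᵀ [⟨Q2(v*(·,t)), δv(·,t)⟩ + ⟨-ε2 λ2_x(·,t) + c1(·) λ1(·,t) + λ2_t(·,t), δv(·,t)⟩] dt + ∫₀ᵀ [R U*(t) + ε2 λ2(1,t)] δU(t) dt + ∫₀ᵀ [-ε1 λ1(1,t) δu(1,t) + ε1 q λ1(0,t) δv(0,t)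 - ε2 λ2(0,t) δv(0,t)] dt + ⟨Pf1(u*(·,T)) - λ1(·,T), δu(·,T)⟩ + ⟨Pf2(v*(·,T)) - λ2(·,T), δv(·,T)⟩. -/
open MeasureTheory intervalIntegral Set

/-- `f : ℝ → ℝ → ℝ` (space, time) is C¹ on `[0,1] × [0,T]`, with spatial partial
derivative `fx` and temporal partial derivative `ft`, both continuous on the rectangle. -/
def C1On2 (T : ℝ) (f fx ft : ℝ → ℝ → ℝ) : Prop :=
  (∀ x ∈ Icc (0:ℝ) 1, ∀ t ∈ Icc (0:ℝ) T,
      HasDerivWithinAt (fun s => f s t) (fx x t) (Icc (0:ℝ) 1) x ∧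
      HasDerivWithinAt (fun s => f x s) (ft x t) (Icc (0:ℝ) T) t) ∧
  ContinuousOn (Function.uncurry f) (Icc (0:ℝ) 1 ×ˢ Icc (0:ℝ) T) ∧
  ContinuousOn (Function.uncurry fx) (Icc (0:ℝ) 1 ×ˢ Icc (0:ℝ) T) ∧
  ContinuousOn (Function.uncurry ft) (Icc (0:ℝ) 1 ×ˢ Icc (0:ℝ) T)

/-- `(u, v, U)` solves the state system
`uₜ = -ε₁ uₓ + c₁(x) v`, `vₜ = ε₂ vₓ + c₂(x) u` on `[0,1] × [0,T]`,
with boundary conditions `u(0,t) = q v(0,t)`, `v(1,t) = U(t)`,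
where `u, v ∈ C¹([0,1] × [0,T])` and `U ∈ C([0,T])`. -/
def SolvesState (ε1 ε2 q T : ℝ) (c1 c2 : ℝ → ℝ) (u v : ℝ → ℝ → ℝ) (U : ℝ → ℝ) : Prop :=
  ∃ ux ut vx vt : ℝ → ℝ → ℝ,
    C1On2 T u ux ut ∧ C1On2 T v vx vt ∧ ContinuousOn U (Icc (0:ℝ) T) ∧
    (∀ x ∈ Icc (0:ℝ) 1, ∀ t ∈ Icc (0:ℝ) T,
      ut x t = -ε1 * ux x t + c1 x * v x t ∧
      vt x t = ε2 * vx x t + c2 x * u x t) ∧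
    (∀ t ∈ Icc (0:ℝ) T, u 0 t = q * v 0 t ∧ v 1 t = U t)

/-- `(λ₁, λ₂)` solves the adjoint (co-state) system associated with `(u, v)`:
`-λ₁ₜ = ε₁ λ₁ₓ + c₂(x) λ₂ + Q₁(u(·,t))(x)`, `-λ₂ₜ = -ε₂ λ₂ₓ + c₁(x) λ₁ + Q₂(v(·,t))(x)`,
with boundary conditions `λ₁(1,t) = 0`, `λ₂(0,t) = q (ε₁/ε₂) λ₁(0,t)` and terminal
conditions `λ₁(x,T) = Pf₁(u(·,T))(x)`, `λ₂(x,T) = Pf₂(v(·,T))(x)`,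
where `λ₁, λ₂ ∈ C¹([0,1] × [0,T])`. -/
def SolvesAdjoint (ε1 ε2 q T : ℝ) (c1 c2 : ℝ → ℝ) (Q1 Q2 Pf1 Pf2 : ℝ → ℝ → ℝ)
    (u v lam1 lam2 : ℝ → ℝ → ℝ) : Prop :=
  ∃ lam1x lam1t lam2x lam2t : ℝ → ℝ → ℝ,
    C1On2 T lam1 lam1x lam1t ∧ C1On2 T lam2 lam2x lam2t ∧
    (∀ x ∈ Icc (0:ℝ) 1, ∀ t ∈ Icc (0:ℝ) T,
      -lam1t x t = ε1 * lam1x x t + c2 x * lam2 x t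
          + (∫ y in (0:ℝ)..1, Q1 x y * u y t) ∧
      -lam2t x t = -ε2 * lam2x x t + c1 x * lam1 x t
          + ∫ y in (0:ℝ)..1, Q2 x y * v y t) ∧
    (∀ t ∈ Icc (0:ℝ) T, lam1 1 t = 0 ∧ lam2 0 t = q * (ε1 / ε2) * lam1 0 t) ∧
    (∀ x ∈ Icc (0:ℝ) 1,
      lam1 x T = (∫ y in (0:ℝ)..1, Pf1 x y * u y T) ∧
      lam2 x T = ∫ y in (0:ℝ)..1, Pf2 x y * v y T)

/-- `(δu, δv, δU)` is an admissible variation: `δu, δv ∈ C¹([0,1] × [0,T])`,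
`δU ∈ C([0,T])`, satisfying the linearized dynamics `δuₜ = -ε₁ δuₓ + c₁(x) δv`,
`δvₜ = ε₂ δvₓ + c₂(x) δu`, the boundary conditions `δu(0,t) = q δv(0,t)`,
`δv(1,t) = δU(t)`, and the zero initial conditions `δu(x,0) = δv(x,0) = 0`. -/
def Admissible (ε1 ε2 q T : ℝ) (c1 c2 : ℝ → ℝ) (du dv : ℝ → ℝ → ℝ) (dU : ℝ → ℝ) : Prop :=
  ∃ dux dut dvx dvt : ℝ → ℝ → ℝ,
    C1On2 T du dux dut ∧ C1On2 T dv dvx dvt ∧ ContinuousOn dU (Icc (0:ℝ) T) ∧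
    (∀ x ∈ Icc (0:ℝ) 1, ∀ t ∈ Icc (0:ℝ) T,
      dut x t = -ε1 * dux x t + c1 x * dv x t ∧
      dvt x t = ε2 * dvx x t + c2 x * du x t) ∧
    (∀ t ∈ Icc (0:ℝ) T, du 0 t = q * dv 0 t ∧ dv 1 t = dU t) ∧
    (∀ x ∈ Icc (0:ℝ) 1, du x 0 = 0 ∧ dv x 0 = 0)

/-- The quadratic cost functional
`J(u,v,U) = ½ ∫₀ᵀ [⟨u, Q₁(u)⟩ + ⟨v, Q₂(v)⟩ + R U(t)²] dt
  + ½ ⟨u(·,T), Pf₁(u(·,T))⟩ + ½ ⟨v(·,T), Pf₂(v(·,T))⟩`,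
where `K(f)(x) = ∫₀¹ K(x,y) f(y) dy` and `⟨f,g⟩ = ∫₀¹ f(x) g(x) dx`. -/
noncomputable def cost (T R : ℝ) (Q1 Q2 Pf1 Pf2 : ℝ → ℝ → ℝ)
    (u v : ℝ → ℝ → ℝ) (U : ℝ → ℝ) : ℝ :=
  (1/2) * (∫ t in (0:ℝ)..T,
      ((∫ x in (0:ℝ)..1, u x t * ∫ y in (0:ℝ)..1, Q1 x y * u y t)
        + (∫ x in (0:ℝ)..1, v x t * ∫ y in (0:ℝ)..1, Q2 x y * v y t)
        + R * U t ^ 2))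
    + (1/2) * (∫ x in (0:ℝ)..1, u x T * ∫ y in (0:ℝ)..1, Pf1 x y * u y T)
    + (1/2) * (∫ x in (0:ℝ)..1, v x T * ∫ y in (0:ℝ)..1, Pf2 x y * v y T)

/-- Integrating out a variable from a compact interval preserves continuity on a set. -/
lemma ContinuousOn.intervalIntegral_right {X : Type*} [TopologicalSpace X]
    [FirstCountableTopology X] {s : Set X} {c d : ℝ} (hcd : c ≤ d) {F : X → ℝ → ℝ}
    (hF : ContinuousOn (Function.uncurry F) (s ×ˢ Icc c d)) :
    ContinuousOn (fun p => ∫ t in c..d, F p t) s := by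
  rw [continuousOn_iff_continuous_domRestrict]
  have h1 : Continuous (Function.uncurry fun (p : s) (t : ℝ) => F p (projIcc c d hcd t)) := by
    have h2 : Continuous fun z : s × ℝ => ((z.1 : X), (projIcc c d hcd z.2 : ℝ)) := by fun_prop
    exact hF.comp_continuous h2 fun z => ⟨z.1.2, (projIcc c d hcd z.2).2⟩
  refine (continuous_parametric_intervalIntegral_of_continuous' (μ := volume) h1 c d).congr
    fun p => integral_congr fun t ht => ?_
  rw [uIcc_of_le hcd] at ht
  simp [projIcc_of_mem hcd ht]

lemma ContinuousOn.intervalIntegral_left {a b c d : ℝ} (hab : a ≤ b) {F : ℝ → ℝ → ℝ}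
    (hF : ContinuousOn (Function.uncurry F) (Icc a b ×ˢ Icc c d)) :
    ContinuousOn (fun t => ∫ x in a..b, F x t) (Icc c d) :=
  ContinuousOn.intervalIntegral_right (F := fun t x => F x t) hab
    (hF.comp continuous_swap.continuousOn fun _ hz => ⟨hz.2, hz.1⟩)

lemma ContinuousOn.section_left {a b c d : ℝ} {F : ℝ → ℝ → ℝ}
    (hF : ContinuousOn (Function.uncurry F) (Icc a b ×ˢ Icc c d)) {t : ℝ} (ht : t ∈ Icc c d) :
    ContinuousOn (fun x => F x t) (Icc a b) :=
  hF.comp (f := fun x => (x, t)) (by fun_prop) fun _ hx => ⟨hx, ht⟩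

lemma ContinuousOn.section_right {a b c d : ℝ} {F : ℝ → ℝ → ℝ}
    (hF : ContinuousOn (Function.uncurry F) (Icc a b ×ˢ Icc c d)) {x : ℝ} (hx : x ∈ Icc a b) :
    ContinuousOn (fun t => F x t) (Icc c d) :=
  hF.comp (f := fun t => (x, t)) (by fun_prop) fun _ ht => ⟨hx, ht⟩

lemma integral_integral_swap_of_continuousOn {a b c d : ℝ} (hab : a ≤ b) (hcd : c ≤ d)
    {F : ℝ → ℝ → ℝ} (hF : ContinuousOn (Function.uncurry F) (Icc a b ×ˢ Icc c d)) :
    ∫ x in a..b, ∫ t in c..d, F x t = ∫ t in c..d, ∫ x in a..b, F x t := by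
  refine intervalIntegral_intervalIntegral_swap ?_
  rw [uIoc_of_le hab, uIoc_of_le hcd]
  exact (hF.integrableOn_compact (isCompact_Icc.prod isCompact_Icc)).mono_set
    (prod_mono Ioc_subset_Icc_self Ioc_subset_Icc_self)

lemma integral_eq_sub_of_hasDerivWithinAt_Icc {a b : ℝ} (hab : a ≤ b) {f f' : ℝ → ℝ}
    (hf : ∀ x ∈ Icc a b, HasDerivWithinAt f (f' x) (Icc a b) x)
    (hf' : ContinuousOn f' (Icc a b)) : ∫ x in a..b, f' x = f b - f a :=
  integral_eq_sub_of_hasDerivAt_of_le hab (fun x hx => (hf x hx).continuousWithinAt)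
    (fun x hx => (hf x (Ioo_subset_Icc_self hx)).hasDerivAt (Icc_mem_nhds hx.1 hx.2))
    (hf'.intervalIntegrable_of_Icc hab)

lemma C1On2.mul {T : ℝ} {f fx ft g gx gt : ℝ → ℝ → ℝ} (hf : C1On2 T f fx ft)
    (hg : C1On2 T g gx gt) :
    C1On2 T (fun x t => f x t * g x t) (fun x t => fx x t * g x t + f x t * gx x t)
      (fun x t => ft x t * g x t + f x t * gt x t) :=
  ⟨fun x hx t ht => ⟨(hf.1 x hx t ht).1.mul (hg.1 x hx t ht).1,
      (hf.1 x hx t ht).2.mul (hg.1 x hx t ht).2⟩,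
    hf.2.1.mul hg.2.1,
    (hf.2.2.1.mul hg.2.1).add (hf.2.1.mul hg.2.2.1),
    (hf.2.2.2.mul hg.2.1).add (hf.2.1.mul hg.2.2.2)⟩

lemma C1On2.integral_time_deriv {T : ℝ} (hT : 0 ≤ T) {f fx ft : ℝ → ℝ → ℝ}
    (hf : C1On2 T f fx ft) :
    ∫ t in (0:ℝ)..T, ∫ x in (0:ℝ)..1, ft x t = ∫ x in (0:ℝ)..1, (f x T - f x 0) := by
  rw [← integral_integral_swap_of_continuousOn zero_le_one hT hf.2.2.2]
  refine integral_congr fun x hx => ?_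
  rw [uIcc_of_le zero_le_one] at hx
  exact integral_eq_sub_of_hasDerivWithinAt_Icc hT (fun t ht => (hf.1 x hx t ht).2)
    (hf.2.2.2.section_right hx)

lemma C1On2.integral_space_deriv {T : ℝ} {f fx ft : ℝ → ℝ → ℝ}
    (hf : C1On2 T f fx ft) {t : ℝ} (ht : t ∈ Icc 0 T) :
    ∫ x in (0:ℝ)..1, fx x t = f 1 t - f 0 t :=
  integral_eq_sub_of_hasDerivWithinAt_Icc zero_le_one (fun x hx => (hf.1 x hx t ht).1)
    (hf.2.2.1.section_left ht)

/-- Continuity in space and time of `K(f(·,t))(x)`. -/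
lemma continuousOn_kernel_apply {T : ℝ} {K f : ℝ → ℝ → ℝ}
    (hK : ContinuousOn (Function.uncurry K) (Icc (0:ℝ) 1 ×ˢ Icc (0:ℝ) 1))
    (hf : ContinuousOn (Function.uncurry f) (Icc (0:ℝ) 1 ×ˢ Icc (0:ℝ) T)) :
    ContinuousOn (Function.uncurry fun x t => ∫ y in (0:ℝ)..1, K x y * f y t)
      (Icc (0:ℝ) 1 ×ˢ Icc (0:ℝ) T) := by
  refine ContinuousOn.intervalIntegral_right (F := fun (p : ℝ × ℝ) y => K p.1 y * f y p.2)
    zero_le_one (ContinuousOn.mul ?_ ?_)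
  · exact hK.comp (f := fun z : (ℝ × ℝ) × ℝ => (z.1.1, z.2)) (by fun_prop)
      fun z hz => ⟨hz.1.1, hz.2⟩
  · exact hf.comp (f := fun z : (ℝ × ℝ) × ℝ => (z.2, z.1.2)) (by fun_prop)
      fun z hz => ⟨hz.2, hz.1.2⟩

/-- A symmetric continuous kernel defines a symmetric operator. -/
lemma integral_kernel_symm {K : ℝ → ℝ → ℝ} {f g : ℝ → ℝ}
    (hK : ContinuousOn (Function.uncurry K) (Icc (0:ℝ) 1 ×ˢ Icc (0:ℝ) 1))
    (hKsym : ∀ x ∈ Icc (0:ℝ) 1, ∀ y ∈ Icc (0:ℝ) 1, K x y = K y x)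
    (hf : ContinuousOn f (Icc (0:ℝ) 1)) (hg : ContinuousOn g (Icc (0:ℝ) 1)) :
    ∫ x in (0:ℝ)..1, f x * ∫ y in (0:ℝ)..1, K x y * g y
      = ∫ x in (0:ℝ)..1, (∫ y in (0:ℝ)..1, K x y * f y) * g x := by
  have hf' : ContinuousOn (fun z : ℝ × ℝ => f z.1) (Icc (0:ℝ) 1 ×ˢ Icc (0:ℝ) 1) :=
    hf.comp (by fun_prop) fun z hz => hz.1
  have hg' : ContinuousOn (fun z : ℝ × ℝ => g z.2) (Icc (0:ℝ) 1 ×ˢ Icc (0:ℝ) 1) :=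
    hg.comp (by fun_prop) fun z hz => hz.2
  simp only [← intervalIntegral.integral_const_mul, ← intervalIntegral.integral_mul_const]
  rw [integral_integral_swap_of_continuousOn (F := fun x y => f x * (K x y * g y))
    zero_le_one zero_le_one (hf'.mul (hK.mul hg'))]
  refine integral_congr fun y hy => integral_congr fun x hx => ?_
  rw [uIcc_of_le zero_le_one] at hx hy
  simp only [hKsym x hx y hy]
  ring

lemma integral_quadratic_of_continuousOn {a b : ℝ} (hab : a ≤ b) {A B C : ℝ → ℝ}
    (hA : ContinuousOn A (Icc a b)) (hB : ContinuousOn B (Icc a b))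
    (hC : ContinuousOn C (Icc a b)) (e : ℝ) :
    ∫ x in a..b, (A x + e * B x + e ^ 2 * C x)
      = (∫ x in a..b, A x) + e * (∫ x in a..b, B x) + e ^ 2 * ∫ x in a..b, C x := by
  have hA' := hA.intervalIntegrable_of_Icc (μ := volume) hab
  have hB' := (hB.intervalIntegrable_of_Icc (μ := volume) hab).const_mul e
  have hC' := (hC.intervalIntegrable_of_Icc (μ := volume) hab).const_mul (e ^ 2)
  rw [intervalIntegral.integral_add (hA'.add hB') hC', intervalIntegral.integral_add hA' hB',
    intervalIntegral.integral_const_mul, intervalIntegral.integral_const_mul]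

/-- Expansion of the quadratic form of a symmetric kernel along a line. -/
lemma integral_kernel_quadratic {K : ℝ → ℝ → ℝ} {f g : ℝ → ℝ}
    (hK : ContinuousOn (Function.uncurry K) (Icc (0:ℝ) 1 ×ˢ Icc (0:ℝ) 1))
    (hKsym : ∀ x ∈ Icc (0:ℝ) 1, ∀ y ∈ Icc (0:ℝ) 1, K x y = K y x)
    (hf : ContinuousOn f (Icc (0:ℝ) 1)) (hg : ContinuousOn g (Icc (0:ℝ) 1)) (e : ℝ) :
    ∫ x in (0:ℝ)..1, (f x + e * g x) * ∫ y in (0:ℝ)..1, K x y * (f y + e * g y)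
      = (∫ x in (0:ℝ)..1, f x * ∫ y in (0:ℝ)..1, K x y * f y)
        + 2 * e * (∫ x in (0:ℝ)..1, (∫ y in (0:ℝ)..1, K x y * f y) * g x)
        + e ^ 2 * ∫ x in (0:ℝ)..1, g x * ∫ y in (0:ℝ)..1, K x y * g y := by
  have hKx : ∀ x ∈ Icc (0:ℝ) 1, ContinuousOn (K x) (Icc (0:ℝ) 1) := fun x hx =>
    hK.section_right hx
  have hop : ∀ h : ℝ → ℝ, ContinuousOn h (Icc (0:ℝ) 1) →
      ContinuousOn (fun x => ∫ y in (0:ℝ)..1, K x y * h y) (Icc (0:ℝ) 1) := fun h hh =>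
    ContinuousOn.intervalIntegral_right zero_le_one
      (hK.mul (hh.comp continuousOn_snd fun z hz => hz.2))
  have hlin : ∀ x ∈ Icc (0:ℝ) 1, ∫ y in (0:ℝ)..1, K x y * (f y + e * g y)
      = (∫ y in (0:ℝ)..1, K x y * f y) + e * ∫ y in (0:ℝ)..1, K x y * g y := fun x hx => by
    rw [← intervalIntegral.integral_const_mul, ← intervalIntegral.integral_add
      (((hKx x hx).fun_mul hf).intervalIntegrable_of_Icc zero_le_one)
      ((((hKx x hx).fun_mul hg).intervalIntegrable_of_Icc zero_le_one).const_mul e)]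
    exact integral_congr fun y _ => by ring
  have hff := hf.fun_mul (hop f hf)
  have hfg := hf.fun_mul (hop g hg)
  have hgf := (hop f hf).fun_mul hg
  have hgg := hg.fun_mul (hop g hg)
  have hexp : ∫ x in (0:ℝ)..1, (f x + e * g x) * ∫ y in (0:ℝ)..1, K x y * (f y + e * g y)
      = ∫ x in (0:ℝ)..1, ((f x * ∫ y in (0:ℝ)..1, K x y * f y)
        + e * ((∫ y in (0:ℝ)..1, K x y * f y) * g x + f x * ∫ y in (0:ℝ)..1, K x y * g y)
        + e ^ 2 * (g x * ∫ y in (0:ℝ)..1, K x y * g y)) := by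
    refine integral_congr fun x hx => ?_
    rw [uIcc_of_le zero_le_one] at hx
    simp only [hlin x hx]
    ring
  rw [hexp, integral_quadratic_of_continuousOn zero_le_one hff (hgf.fun_add hfg) hgg,
    intervalIntegral.integral_add (hgf.intervalIntegrable_of_Icc zero_le_one)
      (hfg.intervalIntegrable_of_Icc zero_le_one), integral_kernel_symm hK hKsym hf hg]
  ring

/-- First variation of the cost, before integrating by parts against the co-states. -/
lemma cost_hasDerivAt {R T : ℝ} (hT : 0 ≤ T) {Q1 Q2 Pf1 Pf2 u v du dv : ℝ → ℝ → ℝ}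
    {U dU : ℝ → ℝ}
    (hQ1 : ContinuousOn (Function.uncurry Q1) (Icc (0:ℝ) 1 ×ˢ Icc (0:ℝ) 1))
    (hQ2 : ContinuousOn (Function.uncurry Q2) (Icc (0:ℝ) 1 ×ˢ Icc (0:ℝ) 1))
    (hPf1 : ContinuousOn (Function.uncurry Pf1) (Icc (0:ℝ) 1 ×ˢ Icc (0:ℝ) 1))
    (hPf2 : ContinuousOn (Function.uncurry Pf2) (Icc (0:ℝ) 1 ×ˢ Icc (0:ℝ) 1))
    (hQ1sym : ∀ x ∈ Icc (0:ℝ) 1, ∀ y ∈ Icc (0:ℝ) 1, Q1 x y = Q1 y x)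
    (hQ2sym : ∀ x ∈ Icc (0:ℝ) 1, ∀ y ∈ Icc (0:ℝ) 1, Q2 x y = Q2 y x)
    (hPf1sym : ∀ x ∈ Icc (0:ℝ) 1, ∀ y ∈ Icc (0:ℝ) 1, Pf1 x y = Pf1 y x)
    (hPf2sym : ∀ x ∈ Icc (0:ℝ) 1, ∀ y ∈ Icc (0:ℝ) 1, Pf2 x y = Pf2 y x)
    (hu : ContinuousOn (Function.uncurry u) (Icc (0:ℝ) 1 ×ˢ Icc (0:ℝ) T))
    (hv : ContinuousOn (Function.uncurry v) (Icc (0:ℝ) 1 ×ˢ Icc (0:ℝ) T))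
    (hU : ContinuousOn U (Icc (0:ℝ) T))
    (hdu : ContinuousOn (Function.uncurry du) (Icc (0:ℝ) 1 ×ˢ Icc (0:ℝ) T))
    (hdv : ContinuousOn (Function.uncurry dv) (Icc (0:ℝ) 1 ×ˢ Icc (0:ℝ) T))
    (hdU : ContinuousOn dU (Icc (0:ℝ) T)) :
    HasDerivAt (fun e : ℝ => cost T R Q1 Q2 Pf1 Pf2
        (fun x t => u x t + e * du x t) (fun x t => v x t + e * dv x t)
        (fun t => U t + e * dU t))
      ((∫ t in (0:ℝ)..T, ∫ x in (0:ℝ)..1, (∫ y in (0:ℝ)..1, Q1 x y * u y t) * du x t)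
        + (∫ t in (0:ℝ)..T, ∫ x in (0:ℝ)..1, (∫ y in (0:ℝ)..1, Q2 x y * v y t) * dv x t)
        + (∫ t in (0:ℝ)..T, R * U t * dU t)
        + (∫ x in (0:ℝ)..1, (∫ y in (0:ℝ)..1, Pf1 x y * u y T) * du x T)
        + ∫ x in (0:ℝ)..1, (∫ y in (0:ℝ)..1, Pf2 x y * v y T) * dv x T) 0 := by
  have hT' : T ∈ Icc (0:ℝ) T := ⟨hT, le_rfl⟩
  have hform : ∀ {K f g : ℝ → ℝ → ℝ},
      ContinuousOn (Function.uncurry K) (Icc (0:ℝ) 1 ×ˢ Icc (0:ℝ) 1) →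
      ContinuousOn (Function.uncurry f) (Icc (0:ℝ) 1 ×ˢ Icc (0:ℝ) T) →
      ContinuousOn (Function.uncurry g) (Icc (0:ℝ) 1 ×ˢ Icc (0:ℝ) T) →
      ContinuousOn (fun t => ∫ x in (0:ℝ)..1, (∫ y in (0:ℝ)..1, K x y * f y t) * g x t)
        (Icc (0:ℝ) T) := fun {K f g} hK hf hg =>
    ContinuousOn.intervalIntegral_left
      (F := fun x t => (∫ y in (0:ℝ)..1, K x y * f y t) * g x t)
      zero_le_one ((continuousOn_kernel_apply hK hf).mul hg)
  have hform' : ∀ {K f : ℝ → ℝ → ℝ},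
      ContinuousOn (Function.uncurry K) (Icc (0:ℝ) 1 ×ˢ Icc (0:ℝ) 1) →
      ContinuousOn (Function.uncurry f) (Icc (0:ℝ) 1 ×ˢ Icc (0:ℝ) T) →
      ContinuousOn (fun t => ∫ x in (0:ℝ)..1, f x t * ∫ y in (0:ℝ)..1, K x y * f y t)
        (Icc (0:ℝ) T) := fun hK hf => by
    simpa only [mul_comm] using hform hK hf hf
  have hB1 := hform hQ1 hu hdu
  have hB2 := hform hQ2 hv hdv
  have hB3 : ContinuousOn (fun t => R * U t * dU t) (Icc (0:ℝ) T) :=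
    (continuousOn_const.fun_mul hU).fun_mul hdU
  have hA := ((hform' hQ1 hu).fun_add (hform' hQ2 hv)).fun_add
    (continuousOn_const (c := R) |>.fun_mul (hU.fun_pow 2))
  have hB := continuousOn_const (c := (2:ℝ)) |>.fun_mul ((hB1.fun_add hB2).fun_add hB3)
  have hC := ((hform' hQ1 hdu).fun_add (hform' hQ2 hdv)).fun_add
    (continuousOn_const (c := R) |>.fun_mul (hdU.fun_pow 2))
  have hrun : ∀ e : ℝ, _ = _ := integral_quadratic_of_continuousOn hT hA hB hC
  have hBsum := intervalIntegral.integral_add (μ := volume)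
    ((hB1.fun_add hB2).intervalIntegrable_of_Icc hT) (hB3.intervalIntegrable_of_Icc hT)
  rw [intervalIntegral.integral_add (hB1.intervalIntegrable_of_Icc hT)
    (hB2.intervalIntegrable_of_Icc hT)] at hBsum
  have hpoly : ∀ a b c : ℝ, HasDerivAt (fun e : ℝ => a + e * b + e ^ 2 * c) b 0 := fun a b c => by
    have h := (((hasDerivAt_id (0:ℝ)).mul_const b).const_add a).add
      ((hasDerivAt_pow 2 (0:ℝ)).mul_const c)
    exact h.congr_deriv (by simp)
  convert hpoly (cost T R Q1 Q2 Pf1 Pf2 u v U) _ (cost T R Q1 Q2 Pf1 Pf2 du dv dU) using 1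
  funext e
  have hrun_e := (integral_congr (μ := volume) (a := 0) (b := T) (f := fun t =>
      (∫ x in (0:ℝ)..1, (u x t + e * du x t) * ∫ y in (0:ℝ)..1, Q1 x y * (u y t + e * du y t))
        + (∫ x in (0:ℝ)..1, (v x t + e * dv x t) * ∫ y in (0:ℝ)..1, Q2 x y * (v y t + e * dv y t))
        + R * (U t + e * dU t) ^ 2) fun t ht => by
    rw [uIcc_of_le hT] at ht
    simp only [integral_kernel_quadratic hQ1 hQ1sym (hu.section_left ht) (hdu.section_left ht),
      integral_kernel_quadratic hQ2 hQ2sym (hv.section_left ht) (hdv.section_left ht)]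
    ring).trans (hrun e)
  simp only [cost]
  rw [hrun_e, integral_kernel_quadratic hPf1 hPf1sym (hu.section_left hT') (hdu.section_left hT'),
    integral_kernel_quadratic hPf2 hPf2sym (hv.section_left hT') (hdv.section_left hT'),
    intervalIntegral.integral_const_mul, hBsum]
  ring

/-- Integration by parts of the linearized dynamics against arbitrary co-states. -/
lemma Admissible.integral_costate {ε1 ε2 q T : ℝ} (hT : 0 ≤ T) {c1 c2 : ℝ → ℝ}
    (hc1 : ContinuousOn c1 (Icc (0:ℝ) 1)) (hc2 : ContinuousOn c2 (Icc (0:ℝ) 1))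
    {lam1 lam1x lam1t lam2 lam2x lam2t du dv : ℝ → ℝ → ℝ} {dU : ℝ → ℝ}
    (hlam1 : C1On2 T lam1 lam1x lam1t) (hlam2 : C1On2 T lam2 lam2x lam2t)
    (hadm : Admissible ε1 ε2 q T c1 c2 du dv dU) :
    (∫ t in (0:ℝ)..T, ∫ x in (0:ℝ)..1,
        (ε1 * lam1x x t + c2 x * lam2 x t + lam1t x t) * du x t)
      + (∫ t in (0:ℝ)..T, ∫ x in (0:ℝ)..1,
        (-ε2 * lam2x x t + c1 x * lam1 x t + lam2t x t) * dv x t)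
      + (∫ t in (0:ℝ)..T, ε2 * lam2 1 t * dU t)
      + (∫ t in (0:ℝ)..T, (-ε1 * lam1 1 t * du 1 t + ε1 * q * lam1 0 t * dv 0 t
          - ε2 * lam2 0 t * dv 0 t))
      = (∫ x in (0:ℝ)..1, lam1 x T * du x T) + ∫ x in (0:ℝ)..1, lam2 x T * dv x T := by
  obtain ⟨dux, dut, dvx, dvt, hdu, hdv, hdU, hdyn, hbc, hic⟩ := hadm
  have h0 : (0:ℝ) ∈ Icc (0:ℝ) 1 := by simp
  have h1 : (1:ℝ) ∈ Icc (0:ℝ) 1 := by simp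
  have hp := hlam1.mul hdu
  have hr := hlam2.mul hdv
  have hc1' : ContinuousOn (fun z : ℝ × ℝ => c1 z.1) (Icc (0:ℝ) 1 ×ˢ Icc (0:ℝ) T) :=
    hc1.comp continuousOn_fst fun z hz => hz.1
  have hc2' : ContinuousOn (fun z : ℝ × ℝ => c2 z.1) (Icc (0:ℝ) 1 ×ˢ Icc (0:ℝ) T) :=
    hc2.comp continuousOn_fst fun z hz => hz.1
  have hF : ContinuousOn (Function.uncurry fun x t =>
      (ε1 * lam1x x t + c2 x * lam2 x t + lam1t x t) * du x t) (Icc (0:ℝ) 1 ×ˢ Icc (0:ℝ) T) :=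
    (((continuousOn_const.mul hlam1.2.2.1).add (hc2'.mul hlam2.2.1)).add hlam1.2.2.2).mul hdu.2.1
  have hG : ContinuousOn (Function.uncurry fun x t =>
      (-ε2 * lam2x x t + c1 x * lam1 x t + lam2t x t) * dv x t) (Icc (0:ℝ) 1 ×ˢ Icc (0:ℝ) T) :=
    (((continuousOn_const.mul hlam2.2.2.1).add (hc1'.mul hlam1.2.1)).add hlam2.2.2.2).mul hdv.2.1
  have hint : ∀ {f : ℝ → ℝ}, ContinuousOn f (Icc (0:ℝ) 1) → IntervalIntegrable f volume 0 1 :=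
    fun h => h.intervalIntegrable_of_Icc zero_le_one
  have hintT : ∀ {f : ℝ → ℝ}, ContinuousOn f (Icc (0:ℝ) T) → IntervalIntegrable f volume 0 T :=
    fun h => h.intervalIntegrable_of_Icc hT
  have hslice : ∀ t ∈ Icc (0:ℝ) T,
      (∫ x in (0:ℝ)..1, (ε1 * lam1x x t + c2 x * lam2 x t + lam1t x t) * du x t)
        + (∫ x in (0:ℝ)..1, (-ε2 * lam2x x t + c1 x * lam1 x t + lam2t x t) * dv x t)
      = (∫ x in (0:ℝ)..1, (lam1t x t * du x t + lam1 x t * dut x t))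
        + (∫ x in (0:ℝ)..1, (lam2t x t * dv x t + lam2 x t * dvt x t))
        + (ε1 * (lam1 1 t * du 1 t - lam1 0 t * du 0 t)
          - ε2 * (lam2 1 t * dv 1 t - lam2 0 t * dv 0 t)) := by
    intro t ht
    rw [← hp.integral_space_deriv ht, ← hr.integral_space_deriv ht,
      ← intervalIntegral.integral_const_mul, ← intervalIntegral.integral_const_mul,
      ← intervalIntegral.integral_add (hint (hF.section_left ht)) (hint (hG.section_left ht)),
      ← intervalIntegral.integral_add (hint (hp.2.2.2.section_left ht))
        (hint (hr.2.2.2.section_left ht)),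
      ← intervalIntegral.integral_sub ((hint (hp.2.2.1.section_left ht)).const_mul ε1)
        ((hint (hr.2.2.1.section_left ht)).const_mul ε2),
      ← intervalIntegral.integral_add
        ((hint (hp.2.2.2.section_left ht)).add (hint (hr.2.2.2.section_left ht)))
        (((hint (hp.2.2.1.section_left ht)).const_mul ε1).sub
          ((hint (hr.2.2.1.section_left ht)).const_mul ε2))]
    refine integral_congr fun x hx => ?_
    rw [uIcc_of_le zero_le_one] at hx
    simp only [(hdyn x hx t ht).1, (hdyn x hx t ht).2]
    ring
  have hFt := hintT (hF.intervalIntegral_left zero_le_one)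
  have hGt := hintT (hG.intervalIntegral_left zero_le_one)
  have hpt := hintT (hp.2.2.2.intervalIntegral_left zero_le_one)
  have hrt := hintT (hr.2.2.2.intervalIntegral_left zero_le_one)
  have hctrl : IntervalIntegrable (fun t => ε2 * lam2 1 t * dU t) volume 0 T :=
    hintT ((continuousOn_const.fun_mul (hlam2.2.1.section_right h1)).fun_mul hdU)
  have hbdry : IntervalIntegrable (fun t => -ε1 * lam1 1 t * du 1 t + ε1 * q * lam1 0 t * dv 0 t
      - ε2 * lam2 0 t * dv 0 t) volume 0 T :=
    hintT ((((continuousOn_const.fun_mul (hlam1.2.1.section_right h1)).fun_mul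
      (hdu.2.1.section_right h1)).fun_add
      ((continuousOn_const.fun_mul (hlam1.2.1.section_right h0)).fun_mul
        (hdv.2.1.section_right h0))).fun_sub
      ((continuousOn_const.fun_mul (hlam2.2.1.section_right h0)).fun_mul
        (hdv.2.1.section_right h0)))
  have hpT := hp.integral_time_deriv hT
  have hrT := hr.integral_time_deriv hT
  have hend : ∀ {l d : ℝ → ℝ → ℝ}, (∀ x ∈ Icc (0:ℝ) 1, d x 0 = 0) →
      ∫ x in (0:ℝ)..1, (l x T * d x T - l x 0 * d x 0) = ∫ x in (0:ℝ)..1, l x T * d x T :=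
    fun hd => integral_congr fun x hx => by
      rw [uIcc_of_le zero_le_one] at hx
      simp [hd x hx]
  rw [hend fun x hx => (hic x hx).1] at hpT
  rw [hend fun x hx => (hic x hx).2] at hrT
  rw [← hpT, ← hrT, ← intervalIntegral.integral_add hpt hrt,
    ← intervalIntegral.integral_add hFt hGt,
    ← intervalIntegral.integral_add (hFt.add hGt) hctrl,
    ← intervalIntegral.integral_add ((hFt.add hGt).add hctrl) hbdry]
  refine integral_congr fun t ht => ?_
  rw [uIcc_of_le hT] at ht
  simp only [hslice t ht, (hbc t ht).1, ← (hbc t ht).2]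
  ring

/-- Gâteaux derivative of the cost along an admissible variation: for arbitrary C¹
co-state candidates `λ₁, λ₂`, the map `ε ↦ J(u* + ε δu, v* + ε δv, U* + ε δU)` is
differentiable at `ε = 0` with derivative given by the weak-variations expression. -/
theorem cost_gateaux_derivative
    (ε1 ε2 q R T : ℝ) (hε1 : 0 < ε1) (hε2 : 0 < ε2) (hq : q ≠ 0) (hR : 0 < R) (hT : 0 < T)
    (c1 c2 : ℝ → ℝ)
    (hc1 : ContinuousOn c1 (Icc (0:ℝ) 1)) (hc2 : ContinuousOn c2 (Icc (0:ℝ) 1))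
    (Q1 Q2 Pf1 Pf2 : ℝ → ℝ → ℝ)
    (hQ1 : ContinuousOn (Function.uncurry Q1) (Icc (0:ℝ) 1 ×ˢ Icc (0:ℝ) 1))
    (hQ2 : ContinuousOn (Function.uncurry Q2) (Icc (0:ℝ) 1 ×ˢ Icc (0:ℝ) 1))
    (hPf1 : ContinuousOn (Function.uncurry Pf1) (Icc (0:ℝ) 1 ×ˢ Icc (0:ℝ) 1))
    (hPf2 : ContinuousOn (Function.uncurry Pf2) (Icc (0:ℝ) 1 ×ˢ Icc (0:ℝ) 1))
    (hQ1sym : ∀ x ∈ Icc (0:ℝ) 1, ∀ y ∈ Icc (0:ℝ) 1, Q1 x y = Q1 y x)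
    (hQ2sym : ∀ x ∈ Icc (0:ℝ) 1, ∀ y ∈ Icc (0:ℝ) 1, Q2 x y = Q2 y x)
    (hPf1sym : ∀ x ∈ Icc (0:ℝ) 1, ∀ y ∈ Icc (0:ℝ) 1, Pf1 x y = Pf1 y x)
    (hPf2sym : ∀ x ∈ Icc (0:ℝ) 1, ∀ y ∈ Icc (0:ℝ) 1, Pf2 x y = Pf2 y x)
    (u v : ℝ → ℝ → ℝ) (U : ℝ → ℝ)
    (hstate : SolvesState ε1 ε2 q T c1 c2 u v U)
    (lam1 lam1x lam1t lam2 lam2x lam2t : ℝ → ℝ → ℝ)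
    (hlam1 : C1On2 T lam1 lam1x lam1t) (hlam2 : C1On2 T lam2 lam2x lam2t)
    (du dv : ℝ → ℝ → ℝ) (dU : ℝ → ℝ)
    (hadm : Admissible ε1 ε2 q T c1 c2 du dv dU) :
    HasDerivAt (fun e : ℝ => cost T R Q1 Q2 Pf1 Pf2
        (fun x t => u x t + e * du x t) (fun x t => v x t + e * dv x t)
        (fun t => U t + e * dU t))
      ((∫ t in (0:ℝ)..T,
          ((∫ x in (0:ℝ)..1, (∫ y in (0:ℝ)..1, Q1 x y * u y t) * du x t)
            + ∫ x in (0:ℝ)..1,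
                (ε1 * lam1x x t + c2 x * lam2 x t + lam1t x t) * du x t))
        + (∫ t in (0:ℝ)..T,
            ((∫ x in (0:ℝ)..1, (∫ y in (0:ℝ)..1, Q2 x y * v y t) * dv x t)
              + ∫ x in (0:ℝ)..1,
                  (-ε2 * lam2x x t + c1 x * lam1 x t + lam2t x t) * dv x t))
        + (∫ t in (0:ℝ)..T, (R * U t + ε2 * lam2 1 t) * dU t)
        + (∫ t in (0:ℝ)..T,
            (-ε1 * lam1 1 t * du 1 t + ε1 * q * lam1 0 t * dv 0 t
              - ε2 * lam2 0 t * dv 0 t))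
        + (∫ x in (0:ℝ)..1, ((∫ y in (0:ℝ)..1, Pf1 x y * u y T) - lam1 x T) * du x T)
        + ∫ x in (0:ℝ)..1, ((∫ y in (0:ℝ)..1, Pf2 x y * v y T) - lam2 x T) * dv x T)
      0 := by
  obtain ⟨ux, ut, vx, vt, hu, hv, hU, -, -⟩ := hstate
  have hcostate := hadm.integral_costate hT.le hc1 hc2 hlam1 hlam2
  obtain ⟨dux, dut, dvx, dvt, hdu, hdv, hdU, -, -, -⟩ := hadm
  convert cost_hasDerivAt (R := R) hT.le hQ1 hQ2 hPf1 hPf2 hQ1sym hQ2sym hPf1sym hPf2sym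
    hu.2.1 hv.2.1 hU hdu.2.1 hdv.2.1 hdU using 1
  have hT' : T ∈ Icc (0:ℝ) T := ⟨hT.le, le_rfl⟩
  have hintT : ∀ {f : ℝ → ℝ}, ContinuousOn f (Icc (0:ℝ) T) → IntervalIntegrable f volume 0 T :=
    fun h => h.intervalIntegrable_of_Icc hT.le
  have hc1' : ContinuousOn (fun z : ℝ × ℝ => c1 z.1) (Icc (0:ℝ) 1 ×ˢ Icc (0:ℝ) T) :=
    hc1.comp continuousOn_fst fun z hz => hz.1
  have hc2' : ContinuousOn (fun z : ℝ × ℝ => c2 z.1) (Icc (0:ℝ) 1 ×ˢ Icc (0:ℝ) T) :=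
    hc2.comp continuousOn_fst fun z hz => hz.1
  have hform : ∀ {K f g : ℝ → ℝ → ℝ},
      ContinuousOn (Function.uncurry K) (Icc (0:ℝ) 1 ×ˢ Icc (0:ℝ) 1) →
      ContinuousOn (Function.uncurry f) (Icc (0:ℝ) 1 ×ˢ Icc (0:ℝ) T) →
      ContinuousOn (Function.uncurry g) (Icc (0:ℝ) 1 ×ˢ Icc (0:ℝ) T) →
      IntervalIntegrable (fun t => ∫ x in (0:ℝ)..1, (∫ y in (0:ℝ)..1, K x y * f y t) * g x t)
        volume 0 T := fun {K f g} hK hf hg =>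
    hintT (ContinuousOn.intervalIntegral_left
      (F := fun x t => (∫ y in (0:ℝ)..1, K x y * f y t) * g x t)
      zero_le_one ((continuousOn_kernel_apply hK hf).mul hg))
  have hF : ContinuousOn (Function.uncurry fun x t =>
      (ε1 * lam1x x t + c2 x * lam2 x t + lam1t x t) * du x t) (Icc (0:ℝ) 1 ×ˢ Icc (0:ℝ) T) :=
    (((continuousOn_const.mul hlam1.2.2.1).add (hc2'.mul hlam2.2.1)).add hlam1.2.2.2).mul hdu.2.1
  have hG : ContinuousOn (Function.uncurry fun x t =>
      (-ε2 * lam2x x t + c1 x * lam1 x t + lam2t x t) * dv x t) (Icc (0:ℝ) 1 ×ˢ Icc (0:ℝ) T) :=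
    (((continuousOn_const.mul hlam2.2.2.1).add (hc1'.mul hlam1.2.1)).add hlam2.2.2.2).mul hdv.2.1
  have hterm : ∀ {K f l d : ℝ → ℝ → ℝ},
      ContinuousOn (Function.uncurry K) (Icc (0:ℝ) 1 ×ˢ Icc (0:ℝ) 1) →
      ContinuousOn (Function.uncurry f) (Icc (0:ℝ) 1 ×ˢ Icc (0:ℝ) T) →
      ContinuousOn (Function.uncurry l) (Icc (0:ℝ) 1 ×ˢ Icc (0:ℝ) T) →
      ContinuousOn (Function.uncurry d) (Icc (0:ℝ) 1 ×ˢ Icc (0:ℝ) T) →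
      ∫ x in (0:ℝ)..1, ((∫ y in (0:ℝ)..1, K x y * f y T) - l x T) * d x T
        = (∫ x in (0:ℝ)..1, (∫ y in (0:ℝ)..1, K x y * f y T) * d x T)
          - ∫ x in (0:ℝ)..1, l x T * d x T := fun hK hf hl hd => by
    simp only [sub_mul]
    exact intervalIntegral.integral_sub
      ((((continuousOn_kernel_apply hK hf).section_left hT').mul
        (hd.section_left hT')).intervalIntegrable_of_Icc zero_le_one)
      (((hl.section_left hT').mul (hd.section_left hT')).intervalIntegrable_of_Icc zero_le_one)
  have hctrl : ∫ t in (0:ℝ)..T, (R * U t + ε2 * lam2 1 t) * dU t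
      = (∫ t in (0:ℝ)..T, R * U t * dU t) + ∫ t in (0:ℝ)..T, ε2 * lam2 1 t * dU t := by
    simp only [add_mul]
    exact intervalIntegral.integral_add (hintT ((continuousOn_const.mul hU).mul hdU))
      (hintT ((continuousOn_const.mul (hlam2.2.1.section_right (by simp))).mul hdU))
  rw [intervalIntegral.integral_add (hform hQ1 hu.2.1 hdu.2.1)
      (hintT (hF.intervalIntegral_left zero_le_one)),
    intervalIntegral.integral_add (hform hQ2 hv.2.1 hdv.2.1)
      (hintT (hG.intervalIntegral_left zero_le_one)),
    hctrl, hterm hPf1 hu.2.1 hlam1.2.1 hdu.2.1, hterm hPf2 hv.2.1 hlam2.2.1 hdv.2.1]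
  linarith
end

section
/- Let ε1, ε2 > 0, R > 0, T > 0, let c1, c2 ∈ ℝ be constants, and let Q2 : [0,1]² → ℝ be continuous. Let u*, v* ∈ C¹([0,1]×[0,T]) satisfy u*_t = -ε1 u*_x + c1 v*, v*_t = ε2 v*_x + c2 u*, and the feedback boundary condition v*(1,t) = -(ε2/R) ∫₀¹ P2(1,y,t) v*(y,t) dy. Let P1, P2 ∈ C¹([0,1]²×[0,T]) satisfy: -∂ₜP2(x,y,t) = -(ε2²/R) P2(x,1,t) P2(1,y,t) - ε2 ∂_y P2(x,y,t) - ε2 ∂ₓP2(x,y,t) + Q2(x,y), c1 P1(x,y,t) + c2 P2(x,y,t) = 0, and P2(x,0,t) = 0 for all (x,y,t). Define λ1(x,t) := ∫₀¹ P1(x,y,t) u*(y,t) dy and λ2(x,t) := ∫₀¹ P2(x,y,t) v*(y,t) dy. Then for all (x,t) ∈ [0,1]×[0,T]: -λ2_t(x,t) = -ε2 λ2_x(x,t) + c1 λ1(x,t) + ∫₀¹ Q2(x,y) v*(y,t) dy. -/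
open MeasureTheory intervalIntegral Set

/-- `P : ℝ → ℝ → ℝ → ℝ`, `(x, y, t) ↦ P x y t`, is C¹ on `[0,1] × [0,1] × [0,T]`,
with partial derivatives `Px`, `Py`, `Pt` in the first, second and third arguments,
all continuous on the box. -/
def C1On3 (T : ℝ) (P Px Py Pt : ℝ → ℝ → ℝ → ℝ) : Prop :=
  (∀ x ∈ Icc (0:ℝ) 1, ∀ y ∈ Icc (0:ℝ) 1, ∀ t ∈ Icc (0:ℝ) T,
      HasDerivWithinAt (fun s => P s y t) (Px x y t) (Icc (0:ℝ) 1) x ∧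
      HasDerivWithinAt (fun s => P x s t) (Py x y t) (Icc (0:ℝ) 1) y ∧
      HasDerivWithinAt (fun s => P x y s) (Pt x y t) (Icc (0:ℝ) T) t) ∧
  ContinuousOn (fun p : ℝ × ℝ × ℝ => P p.1 p.2.1 p.2.2)
    (Icc (0:ℝ) 1 ×ˢ Icc (0:ℝ) 1 ×ˢ Icc (0:ℝ) T) ∧
  ContinuousOn (fun p : ℝ × ℝ × ℝ => Px p.1 p.2.1 p.2.2)
    (Icc (0:ℝ) 1 ×ˢ Icc (0:ℝ) 1 ×ˢ Icc (0:ℝ) T) ∧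
  ContinuousOn (fun p : ℝ × ℝ × ℝ => Py p.1 p.2.1 p.2.2)
    (Icc (0:ℝ) 1 ×ˢ Icc (0:ℝ) 1 ×ˢ Icc (0:ℝ) T) ∧
  ContinuousOn (fun p : ℝ × ℝ × ℝ => Pt p.1 p.2.1 p.2.2)
    (Icc (0:ℝ) 1 ×ˢ Icc (0:ℝ) 1 ×ˢ Icc (0:ℝ) T)

/-- Differentiation under the integral sign relative to a convex parameter set, for an integrand
whose derivative within that set is bounded. -/
theorem hasDerivWithinAt_intervalIntegral_of_bounded {F F' : ℝ → ℝ → ℝ} {S : Set ℝ} {a b t C : ℝ}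
    (hab : a ≤ b) (hS : Convex ℝ S) (ht : t ∈ S)
    (hF : ∀ s ∈ S, ContinuousOn (fun y => F y s) (Icc a b))
    (hd : ∀ y ∈ Icc a b, ∀ s ∈ S, HasDerivWithinAt (F y) (F' y s) S s)
    (hC : ∀ y ∈ Icc a b, ∀ s ∈ S, ‖F' y s‖ ≤ C) :
    HasDerivWithinAt (fun s => ∫ y in a..b, F y s) (∫ y in a..b, F' y t) S t := by
  have hint : ∀ s ∈ S, IntervalIntegrable (fun y => F y s) volume a b := fun s hs =>
    (hF s hs).intervalIntegrable_of_Icc hab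
  have hsub : uIoc a b ⊆ Icc a b := by
    rw [uIoc_of_le hab]
    exact Ioc_subset_Icc_self
  rw [hasDerivWithinAt_iff_tendsto_slope]
  have key : Filter.Tendsto (fun s => ∫ y in a..b, slope (F y) t s) (nhdsWithin t (S \ {t}))
      (nhds (∫ y in a..b, F' y t)) := by
    refine intervalIntegral.tendsto_integral_filter_of_dominated_convergence (fun _ => C) ?_ ?_
      intervalIntegrable_const ?_
    · filter_upwards [self_mem_nhdsWithin] with s hs
      have h := ((hint s hs.1).sub (hint t ht)).const_mul (s - t)⁻¹
      simpa [slope_def_field, div_eq_inv_mul] using h.def'.aestronglyMeasurable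
    · filter_upwards [self_mem_nhdsWithin] with s hs
      refine Filter.Eventually.of_forall fun y hy => ?_
      have h := hS.norm_image_sub_le_of_norm_hasDerivWithin_le (hd y (hsub hy)) (hC y (hsub hy))
        ht hs.1
      have hpos : 0 < ‖s - t‖ := norm_pos_iff.2 (sub_ne_zero.2 hs.2)
      rw [slope_def_field, norm_div]
      exact (div_le_iff₀ hpos).2 h
    · refine Filter.Eventually.of_forall fun y hy => ?_
      exact (hasDerivWithinAt_iff_tendsto_slope).1 (hd y (hsub hy) t ht)
  refine key.congr' ?_
  filter_upwards [self_mem_nhdsWithin] with s hs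
  simp only [slope_def_field]
  rw [intervalIntegral.integral_div, intervalIntegral.integral_sub (hint s hs.1) (hint t ht)]

/-- Differentiation under the integral sign on a compact rectangle. -/
theorem hasDerivWithinAt_intervalIntegral_of_continuousOn {F F' : ℝ → ℝ → ℝ} {a b c d t : ℝ}
    (hab : a ≤ b) (ht : t ∈ Icc c d)
    (hF : ∀ s ∈ Icc c d, ContinuousOn (fun y => F y s) (Icc a b))
    (hd : ∀ y ∈ Icc a b, ∀ s ∈ Icc c d, HasDerivWithinAt (F y) (F' y s) (Icc c d) s)
    (hF' : ContinuousOn (Function.uncurry F') (Icc a b ×ˢ Icc c d)) :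
    HasDerivWithinAt (fun s => ∫ y in a..b, F y s) (∫ y in a..b, F' y t) (Icc c d) t := by
  obtain ⟨C, hC⟩ := (isCompact_Icc.prod isCompact_Icc).exists_bound_of_continuousOn hF'
  exact hasDerivWithinAt_intervalIntegral_of_bounded hab (convex_Icc c d) ht hF hd
    fun y hy s hs => hC (y, s) ⟨hy, hs⟩

/-- The transformation `λ₁(x,t) = ∫₀¹ P₁(x,y,t) u*(y,t) dy`, `λ₂(x,t) = ∫₀¹ P₂(x,y,t) v*(y,t) dy`
turns a solution of the differential algebraic Riccati equation for `P₂` (together with the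
algebraic constraint `c₁ P₁ + c₂ P₂ = 0`, the boundary condition `P₂(x,0,t) = 0`, and the
state-feedback control `U*(t) = -(ε₂/R) ∫₀¹ P₂(1,y,t) v*(y,t) dy` applied at `x = 1`)
into a solution of the second adjoint equation
`-λ₂ₜ = -ε₂ λ₂ₓ + c₁ λ₁ + ∫₀¹ Q₂(x,y) v*(y,t) dy`. -/
theorem second_adjoint_equation_from_riccati
    (ε1 ε2 R T c1 c2 : ℝ) (hε1 : 0 < ε1) (hε2 : 0 < ε2) (hR : 0 < R) (hT : 0 < T)
    (Q2 : ℝ → ℝ → ℝ)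
    (hQ2 : ContinuousOn (Function.uncurry Q2) (Icc (0:ℝ) 1 ×ˢ Icc (0:ℝ) 1))
    (u ux ut v vx vt : ℝ → ℝ → ℝ)
    (hu : C1On2 T u ux ut) (hv : C1On2 T v vx vt)
    (P1 P1x P1y P1t P2 P2x P2y P2t : ℝ → ℝ → ℝ → ℝ)
    (hP1 : C1On3 T P1 P1x P1y P1t) (hP2 : C1On3 T P2 P2x P2y P2t)
    (hpde1 : ∀ x ∈ Icc (0:ℝ) 1, ∀ t ∈ Icc (0:ℝ) T,
      ut x t = -ε1 * ux x t + c1 * v x t)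
    (hpde2 : ∀ x ∈ Icc (0:ℝ) 1, ∀ t ∈ Icc (0:ℝ) T,
      vt x t = ε2 * vx x t + c2 * u x t)
    (hfeedback : ∀ t ∈ Icc (0:ℝ) T,
      v 1 t = -(ε2 / R) * ∫ y in (0:ℝ)..1, P2 1 y t * v y t)
    (hric2 : ∀ x ∈ Icc (0:ℝ) 1, ∀ y ∈ Icc (0:ℝ) 1, ∀ t ∈ Icc (0:ℝ) T,
      -P2t x y t = -(ε2 ^ 2 / R) * P2 x 1 t * P2 1 y t
        - ε2 * P2y x y t - ε2 * P2x x y t + Q2 x y)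
    (halg : ∀ x ∈ Icc (0:ℝ) 1, ∀ y ∈ Icc (0:ℝ) 1, ∀ t ∈ Icc (0:ℝ) T,
      c1 * P1 x y t + c2 * P2 x y t = 0)
    (hP2bc0 : ∀ x ∈ Icc (0:ℝ) 1, ∀ t ∈ Icc (0:ℝ) T, P2 x 0 t = 0) :
    ∀ x ∈ Icc (0:ℝ) 1, ∀ t ∈ Icc (0:ℝ) T,
      ∃ d2t d2x : ℝ,
        HasDerivWithinAt (fun s => ∫ y in (0:ℝ)..1, P2 x y s * v y s) d2t (Icc (0:ℝ) T) t ∧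
        HasDerivWithinAt (fun s => ∫ y in (0:ℝ)..1, P2 s y t * v y t) d2x (Icc (0:ℝ) 1) x ∧
        -d2t = -ε2 * d2x + c1 * (∫ y in (0:ℝ)..1, P1 x y t * u y t)
          + ∫ y in (0:ℝ)..1, Q2 x y * v y t := by
  intro x hx t ht
  obtain ⟨hvd, hvc, hvxc, hvtc⟩ := hv
  obtain ⟨hPd, hPc, hPxc, hPyc, hPtc⟩ := hP2
  have h01 : (0 : ℝ) ≤ 1 := zero_le_one
  have h1 : (1 : ℝ) ∈ Icc (0 : ℝ) 1 := right_mem_Icc.2 h01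
  have slice : ∀ {f : ℝ → ℝ → ℝ}, ContinuousOn (Function.uncurry f) (Icc 0 1 ×ˢ Icc 0 T) →
      ∀ s ∈ Icc 0 T, ContinuousOn (fun y => f y s) (Icc 0 1) := fun hf s hs =>
    hf.comp (f := fun y => (y, s)) (by fun_prop) fun y hy => ⟨hy, hs⟩
  have slice3 : ∀ {f : ℝ → ℝ → ℝ → ℝ},
      ContinuousOn (fun p : ℝ × ℝ × ℝ => f p.1 p.2.1 p.2.2) (Icc 0 1 ×ˢ Icc 0 1 ×ˢ Icc 0 T) →
      ∀ z ∈ Icc (0 : ℝ) 1, ∀ s ∈ Icc 0 T, ContinuousOn (fun y => f z y s) (Icc 0 1) :=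
    fun hf z hz s hs =>
      hf.comp (f := fun y => (z, y, s)) (by fun_prop) fun y hy => ⟨hz, hy, hs⟩
  have sliceT : ∀ {f : ℝ → ℝ → ℝ → ℝ},
      ContinuousOn (fun p : ℝ × ℝ × ℝ => f p.1 p.2.1 p.2.2) (Icc 0 1 ×ˢ Icc 0 1 ×ˢ Icc 0 T) →
      ContinuousOn (fun p : ℝ × ℝ => f x p.1 p.2) (Icc 0 1 ×ˢ Icc 0 T) := fun hf =>
    hf.comp (f := fun p : ℝ × ℝ => (x, p.1, p.2)) (by fun_prop) fun p hp => ⟨hx, hp.1, hp.2⟩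
  have cv := slice hvc t ht
  have cvx := slice hvxc t ht
  have cu := slice hu.2.1 t ht
  have cP := slice3 hPc x hx t ht
  have cPx := slice3 hPxc x hx t ht
  have cPy := slice3 hPyc x hx t ht
  have cP1 := slice3 hPc 1 h1 t ht
  have cQ : ContinuousOn (fun y => Q2 x y) (Icc 0 1) :=
    hQ2.comp (f := fun y => (x, y)) (by fun_prop) fun y hy => ⟨hx, hy⟩
  have ii : ∀ {f : ℝ → ℝ}, ContinuousOn f (Icc 0 1) → IntervalIntegrable f volume 0 1 :=
    fun hf => hf.intervalIntegrable_of_Icc h01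
  have hparts : ∫ y in (0 : ℝ)..1, (P2y x y t * v y t + P2 x y t * vx y t)
      = P2 x 1 t * v 1 t := by
    have h := intervalIntegral.integral_eq_sub_of_hasDerivAt_of_le h01 (cP.mul cv)
      (f' := fun y => P2y x y t * v y t + P2 x y t * vx y t)
      (fun y hy => by
        have hy' := Ioo_subset_Icc_self hy
        exact ((hPd x hx y hy' t ht).2.1.mul (hvd y hy' t ht).1).hasDerivAt
          (Icc_mem_nhds hy.1 hy.2))
      (ii ((cPy.mul cv).add (cP.mul cvx)))
    simpa [hP2bc0 x hx t ht] using h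
  refine ⟨∫ y in (0 : ℝ)..1, (P2t x y t * v y t + P2 x y t * vt y t),
    ∫ y in (0 : ℝ)..1, P2x x y t * v y t, ?_, ?_, ?_⟩
  · refine hasDerivWithinAt_intervalIntegral_of_continuousOn
      (F := fun y s => P2 x y s * v y s)
      (F' := fun y s => P2t x y s * v y s + P2 x y s * vt y s) h01 ht
      (fun s hs => (slice3 hPc x hx s hs).mul (slice hvc s hs))
      (fun y hy s hs => (hPd x hx y hy s hs).2.2.mul (hvd y hy s hs).2) ?_
    exact ((sliceT hPtc).mul hvc).add ((sliceT hPc).mul hvtc)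
  · refine hasDerivWithinAt_intervalIntegral_of_continuousOn
      (F := fun y s => P2 s y t * v y t)
      (F' := fun y s => P2x s y t * v y t) h01 hx
      (fun s hs => (slice3 hPc s hs t ht).mul cv)
      (fun y hy s hs => (hPd s hs y hy t ht).1.mul_const _) ?_
    exact (hPxc.comp (f := fun p : ℝ × ℝ => (p.2, p.1, t)) (by fun_prop)
      fun p hp => ⟨hp.2, hp.1, ht⟩).mul
      (cv.comp (f := fun p : ℝ × ℝ => p.1) (by fun_prop) fun p hp => hp.1)
  · have hexpand : ∫ y in (0 : ℝ)..1, (P2t x y t * v y t + P2 x y t * vt y t)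
        = ∫ y in (0 : ℝ)..1, (ε2 ^ 2 / R * P2 x 1 t * (P2 1 y t * v y t)
          + ε2 * (P2y x y t * v y t + P2 x y t * vx y t) + ε2 * (P2x x y t * v y t)
          - Q2 x y * v y t - c1 * (P1 x y t * u y t)) := by
      refine intervalIntegral.integral_congr fun y hy => ?_
      rw [uIcc_of_le h01] at hy
      simp only [hpde2 y hy t ht]
      linear_combination (-v y t) * hric2 x hx y hy t ht + u y t * halg x hx y hy t ht
    have i1 : IntervalIntegrable (fun y => ε2 ^ 2 / R * P2 x 1 t * (P2 1 y t * v y t)) volume 0 1 :=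
      (ii (cP1.mul cv)).const_mul _
    have i2 : IntervalIntegrable (fun y => ε2 * (P2y x y t * v y t + P2 x y t * vx y t))
        volume 0 1 := (ii ((cPy.mul cv).add (cP.mul cvx))).const_mul ε2
    have i3 : IntervalIntegrable (fun y => ε2 * (P2x x y t * v y t)) volume 0 1 :=
      (ii (cPx.mul cv)).const_mul ε2
    have i4 : IntervalIntegrable (fun y => Q2 x y * v y t) volume 0 1 := ii (cQ.mul cv)
    have i5 : IntervalIntegrable (fun y => c1 * (P1 x y t * u y t)) volume 0 1 :=
      (ii ((slice3 hP1.2.1 x hx t ht).mul cu)).const_mul c1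
    have i12 : IntervalIntegrable (fun y => ε2 ^ 2 / R * P2 x 1 t * (P2 1 y t * v y t)
        + ε2 * (P2y x y t * v y t + P2 x y t * vx y t)) volume 0 1 := i1.add i2
    have i123 : IntervalIntegrable (fun y => ε2 ^ 2 / R * P2 x 1 t * (P2 1 y t * v y t)
        + ε2 * (P2y x y t * v y t + P2 x y t * vx y t) + ε2 * (P2x x y t * v y t))
        volume 0 1 := i12.add i3
    have i1234 : IntervalIntegrable (fun y => ε2 ^ 2 / R * P2 x 1 t * (P2 1 y t * v y t)
        + ε2 * (P2y x y t * v y t + P2 x y t * vx y t) + ε2 * (P2x x y t * v y t)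
        - Q2 x y * v y t) volume 0 1 := i123.sub i4
    rw [hexpand, intervalIntegral.integral_sub i1234 i5, intervalIntegral.integral_sub i123 i4,
      intervalIntegral.integral_add i12 i3, intervalIntegral.integral_add i1 i2]
    simp only [intervalIntegral.integral_const_mul]
    rw [hparts]
    linear_combination (-ε2 * P2 x 1 t) * hfeedback t ht
end

section
/- Let ε1, ε2 > 0, q ∈ ℝ, R > 0, T > 0, let c1, c2 ∈ ℝ be constants, and let Q1, Q2 : [0,1]² → ℝ be continuous. Suppose P1∞, P2∞ ∈ C¹([0,1]²) (time-independent kernels) satisfy the steady-state algebraic Riccati system: -(ε2²/R) P2∞(x,1) P2∞(1,y) - ε2 ∂_y P2∞(x,y) - ε2 ∂ₓP2∞(x,y) = -Q2(x,y), ε1 ∂_y P1∞(x,y) + ε1 ∂ₓP1∞(x,y) = -Q1(x,y), c1 P1∞(x,y) + c2 P2∞(x,y) = 0, with boundary conditions P2∞(x,0) = 0, P1∞(x,1) = 0, P1∞(x,0) = 0, P1∞(1,y) = 0, P1∞(0,y) = 0, P2∞(0,y) = 0. Suppose u*, v* ∈ C¹([0,1]×[0,T]) satisfy u*_t = -ε1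 u*_x + c1 v*, v*_t = ε2 v*_x + c2 u*, u*(0,t) = q v*(0,t), and v*(1,t) = -(ε2/R) ∫₀¹ P2∞(1,y) v*(y,t) dy. Then λ1(x,t) := ∫₀¹ P1∞(x,y) u*(y,t) dy and λ2(x,t) := ∫₀¹ P2∞(x,y) v*(y,t) dy satisfy, for all (x,t) ∈ [0,1]×[0,T]: -λ1_t = ε1 λ1_x + c2 λ2 + ∫₀¹ Q1(x,y) u*(y,t) dy, -λ2_t = -ε2 λ2_x + c1 λ1 + ∫₀¹ Q2(x,y) v*(y,t) dy, λ1(1,t) = 0, and λ2(0,t) = q (ε1/ε2) λ1(0,t). -/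
open MeasureTheory intervalIntegral Set

/-- A time-independent kernel `P : ℝ → ℝ → ℝ`, `(x, y) ↦ P x y`, is C¹ on `[0,1]²`,
with partial derivatives `Px`, `Py` in the first and second arguments, all continuous
on the square. -/
def C1Sq (P Px Py : ℝ → ℝ → ℝ) : Prop :=
  (∀ x ∈ Icc (0:ℝ) 1, ∀ y ∈ Icc (0:ℝ) 1,
      HasDerivWithinAt (fun s => P s y) (Px x y) (Icc (0:ℝ) 1) x ∧
      HasDerivWithinAt (fun s => P x s) (Py x y) (Icc (0:ℝ) 1) y) ∧
  ContinuousOn (Function.uncurry P) (Icc (0:ℝ) 1 ×ˢ Icc (0:ℝ) 1) ∧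
  ContinuousOn (Function.uncurry Px) (Icc (0:ℝ) 1 ×ˢ Icc (0:ℝ) 1) ∧
  ContinuousOn (Function.uncurry Py) (Icc (0:ℝ) 1 ×ˢ Icc (0:ℝ) 1)

/-- Differentiation under the integral sign, with one-sided derivatives allowed at the boundary of
the compact convex parameter set `S`. -/
theorem hasDerivWithinAt_intervalIntegral_of_continuousOn_s11 {S : Set ℝ} {a b : ℝ}
    (hS : Convex ℝ S) (hSc : IsCompact S) {f f' : ℝ → ℝ → ℝ}
    (hf : ∀ s ∈ S, ContinuousOn (f s) (uIcc a b))
    (hf' : ContinuousOn (Function.uncurry f') (S ×ˢ uIcc a b))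
    (hd : ∀ s ∈ S, ∀ y ∈ uIcc a b, HasDerivWithinAt (fun r => f r y) (f' s y) S s)
    {s : ℝ} (hs : s ∈ S) :
    HasDerivWithinAt (fun r => ∫ y in a..b, f r y) (∫ y in a..b, f' s y) S s := by
  obtain ⟨C, hC⟩ := (hSc.prod isCompact_uIcc).exists_bound_of_continuousOn hf'
  rw [hasDerivWithinAt_iff_tendsto_slope]
  have hev : ∀ᶠ r in nhdsWithin s (S \ {s}), r ∈ S ∧ r ≠ s := self_mem_nhdsWithin
  have hslope : ∀ᶠ r in nhdsWithin s (S \ {s}),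
      ∫ y in a..b, slope (fun r => f r y) s r = slope (fun r => ∫ y in a..b, f r y) s r := by
    filter_upwards [hev] with r hr
    simp only [slope_def_field, div_eq_mul_inv]
    rw [intervalIntegral.integral_mul_const, intervalIntegral.integral_sub
      (hf r hr.1).intervalIntegrable (hf s hs).intervalIntegrable]
  refine Filter.Tendsto.congr' hslope ?_
  refine intervalIntegral.tendsto_integral_filter_of_dominated_convergence (fun _ => C)
    ?_ ?_ intervalIntegrable_const ?_
  · filter_upwards [hev] with r hr
    simp only [slope_def_field, div_eq_mul_inv]
    exact ((((hf r hr.1).sub (hf s hs)).mul continuousOn_const).mono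
      uIoc_subset_uIcc).aestronglyMeasurable measurableSet_uIoc
  · filter_upwards [hev] with r hr
    refine Filter.Eventually.of_forall fun y hy => ?_
    have hle := hS.norm_image_sub_le_of_norm_hasDerivWithin_le
      (fun x hx => hd x hx y (uIoc_subset_uIcc hy))
      (fun x hx => hC (x, y) ⟨hx, uIoc_subset_uIcc hy⟩) hs hr.1
    have hpos : 0 < ‖r - s‖ := norm_pos_iff.2 (sub_ne_zero.2 hr.2)
    rw [slope_def_field, norm_div, div_le_iff₀ hpos]
    exact hle
  · exact Filter.Eventually.of_forall fun y hy =>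
      hasDerivWithinAt_iff_tendsto_slope.1 (hd s hs y (uIoc_subset_uIcc hy))

theorem ContinuousOn.uncurry_section_right {f : ℝ → ℝ → ℝ} {A B : Set ℝ}
    (hf : ContinuousOn (Function.uncurry f) (A ×ˢ B)) {x : ℝ} (hx : x ∈ A) :
    ContinuousOn (f x) B :=
  hf.comp (f := fun y => (x, y)) (by fun_prop) fun _ hy => ⟨hx, hy⟩

theorem ContinuousOn.uncurry_section_left {f : ℝ → ℝ → ℝ} {A B : Set ℝ}
    (hf : ContinuousOn (Function.uncurry f) (A ×ˢ B)) {y : ℝ} (hy : y ∈ B) :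
    ContinuousOn (fun x => f x y) A :=
  hf.comp (f := fun x => (x, y)) (by fun_prop) fun _ hx => ⟨hx, hy⟩

theorem C1Sq.hasDerivWithinAt_integral_mul {P Px Py : ℝ → ℝ → ℝ} (hP : C1Sq P Px Py)
    {w : ℝ → ℝ} (hw : ContinuousOn w (Icc 0 1)) {x : ℝ} (hx : x ∈ Icc (0:ℝ) 1) :
    HasDerivWithinAt (fun s => ∫ y in (0:ℝ)..1, P s y * w y)
      (∫ y in (0:ℝ)..1, Px x y * w y) (Icc 0 1) x := by
  obtain ⟨hd, hc, hcx, -⟩ := hP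
  have h01 : uIcc (0:ℝ) 1 = Icc 0 1 := uIcc_of_le zero_le_one
  refine hasDerivWithinAt_intervalIntegral_of_continuousOn_s11 (f := fun s y => P s y * w y)
    (f' := fun s y => Px s y * w y) (convex_Icc 0 1) isCompact_Icc ?_ ?_ ?_ hx <;> rw [h01]
  · exact fun s hs => (hc.uncurry_section_right hs).mul hw
  · exact hcx.mul (hw.comp continuousOn_snd fun _ hz => hz.2)
  · exact fun s hs y hy => (hd s hs y hy).1.mul_const (w y)

theorem C1On2.hasDerivWithinAt_integral_mul {T : ℝ} {f fx ft : ℝ → ℝ → ℝ} (hf : C1On2 T f fx ft)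
    {p : ℝ → ℝ} (hp : ContinuousOn p (Icc 0 1)) {t : ℝ} (ht : t ∈ Icc 0 T) :
    HasDerivWithinAt (fun s => ∫ y in (0:ℝ)..1, p y * f y s)
      (∫ y in (0:ℝ)..1, p y * ft y t) (Icc 0 T) t := by
  obtain ⟨hd, hc, -, hct⟩ := hf
  have h01 : uIcc (0:ℝ) 1 = Icc 0 1 := uIcc_of_le zero_le_one
  refine hasDerivWithinAt_intervalIntegral_of_continuousOn_s11 (f := fun s y => p y * f y s)
    (f' := fun s y => p y * ft y s) (convex_Icc 0 T) isCompact_Icc ?_ ?_ ?_ ht <;> rw [h01]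
  · exact fun s hs => hp.mul (hc.uncurry_section_left hs)
  · exact (hp.comp continuousOn_snd fun _ hz => hz.2).mul
      (hct.comp continuous_swap.continuousOn fun _ hz => ⟨hz.2, hz.1⟩)
  · exact fun s hs y hy => (hd y hy s hs).2.const_mul (p y)

/-- Integration by parts in the integration variable of a kernel against a state. -/
theorem C1Sq.integral_mul_deriv {T : ℝ} {P Px Py f fx ft : ℝ → ℝ → ℝ} (hP : C1Sq P Px Py)
    (hf : C1On2 T f fx ft) {x t : ℝ} (hx : x ∈ Icc (0:ℝ) 1) (ht : t ∈ Icc 0 T) :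
    ∫ y in (0:ℝ)..1, P x y * fx y t
      = P x 1 * f 1 t - P x 0 * f 0 t - ∫ y in (0:ℝ)..1, Py x y * f y t := by
  have h01 : uIcc (0:ℝ) 1 = Icc 0 1 := uIcc_of_le zero_le_one
  refine intervalIntegral.integral_mul_deriv_eq_deriv_mul_of_hasDerivWithinAt
    (u := P x) (v := fun y => f y t) ?_ ?_ ?_ ?_
  · rw [h01]
    exact fun y hy => (hP.1 x hx y hy).2
  · rw [h01]
    exact fun y hy => (hf.1 y hy t ht).1
  · refine ContinuousOn.intervalIntegrable ?_
    rw [h01]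
    exact hP.2.2.2.uncurry_section_right hx
  · refine ContinuousOn.intervalIntegrable ?_
    rw [h01]
    exact hf.2.2.1.uncurry_section_left ht

/-- Infinite-time-horizon (steady-state) version of the state-feedback result:
a stationary solution `P₁∞, P₂∞` of the differential algebraic Riccati equations yields,
via the time-invariant feedback `U*(t) = -(ε₂/R) ∫₀¹ P₂∞(1,y) v*(y,t) dy`, co-states
`λ₁(x,t) = ∫₀¹ P₁∞(x,y) u*(y,t) dy` and `λ₂(x,t) = ∫₀¹ P₂∞(x,y) v*(y,t) dy` that satisfy
the adjoint equations and boundary conditions of the first-order optimality system. -/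
theorem steady_state_riccati_yields_adjoint_system
    (ε1 ε2 q R T c1 c2 : ℝ) (hε1 : 0 < ε1) (hε2 : 0 < ε2) (hR : 0 < R) (hT : 0 < T)
    (Q1 Q2 : ℝ → ℝ → ℝ)
    (hQ1 : ContinuousOn (Function.uncurry Q1) (Icc (0:ℝ) 1 ×ˢ Icc (0:ℝ) 1))
    (hQ2 : ContinuousOn (Function.uncurry Q2) (Icc (0:ℝ) 1 ×ˢ Icc (0:ℝ) 1))
    (P1i P1ix P1iy P2i P2ix P2iy : ℝ → ℝ → ℝ)
    (hP1i : C1Sq P1i P1ix P1iy) (hP2i : C1Sq P2i P2ix P2iy)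
    (hric2 : ∀ x ∈ Icc (0:ℝ) 1, ∀ y ∈ Icc (0:ℝ) 1,
      -(ε2 ^ 2 / R) * P2i x 1 * P2i 1 y - ε2 * P2iy x y - ε2 * P2ix x y = -Q2 x y)
    (hric1 : ∀ x ∈ Icc (0:ℝ) 1, ∀ y ∈ Icc (0:ℝ) 1,
      ε1 * P1iy x y + ε1 * P1ix x y = -Q1 x y)
    (halg : ∀ x ∈ Icc (0:ℝ) 1, ∀ y ∈ Icc (0:ℝ) 1,
      c1 * P1i x y + c2 * P2i x y = 0)
    (hbcP2y0 : ∀ x ∈ Icc (0:ℝ) 1, P2i x 0 = 0)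
    (hbcP1y1 : ∀ x ∈ Icc (0:ℝ) 1, P1i x 1 = 0)
    (hbcP1y0 : ∀ x ∈ Icc (0:ℝ) 1, P1i x 0 = 0)
    (hbcP1x1 : ∀ y ∈ Icc (0:ℝ) 1, P1i 1 y = 0)
    (hbcP1x0 : ∀ y ∈ Icc (0:ℝ) 1, P1i 0 y = 0)
    (hbcP2x0 : ∀ y ∈ Icc (0:ℝ) 1, P2i 0 y = 0)
    (u ux ut v vx vt : ℝ → ℝ → ℝ)
    (hu : C1On2 T u ux ut) (hv : C1On2 T v vx vt)
    (hpde1 : ∀ x ∈ Icc (0:ℝ) 1, ∀ t ∈ Icc (0:ℝ) T,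
      ut x t = -ε1 * ux x t + c1 * v x t)
    (hpde2 : ∀ x ∈ Icc (0:ℝ) 1, ∀ t ∈ Icc (0:ℝ) T,
      vt x t = ε2 * vx x t + c2 * u x t)
    (hbcu : ∀ t ∈ Icc (0:ℝ) T, u 0 t = q * v 0 t)
    (hfeedback : ∀ t ∈ Icc (0:ℝ) T,
      v 1 t = -(ε2 / R) * ∫ y in (0:ℝ)..1, P2i 1 y * v y t) :
    (∀ x ∈ Icc (0:ℝ) 1, ∀ t ∈ Icc (0:ℝ) T,
      ∃ d1t d1x d2t d2x : ℝ,
        HasDerivWithinAt (fun s => ∫ y in (0:ℝ)..1, P1i x y * u y s) d1t (Icc (0:ℝ) T) t ∧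
        HasDerivWithinAt (fun s => ∫ y in (0:ℝ)..1, P1i s y * u y t) d1x (Icc (0:ℝ) 1) x ∧
        HasDerivWithinAt (fun s => ∫ y in (0:ℝ)..1, P2i x y * v y s) d2t (Icc (0:ℝ) T) t ∧
        HasDerivWithinAt (fun s => ∫ y in (0:ℝ)..1, P2i s y * v y t) d2x (Icc (0:ℝ) 1) x ∧
        -d1t = ε1 * d1x + c2 * (∫ y in (0:ℝ)..1, P2i x y * v y t)
          + (∫ y in (0:ℝ)..1, Q1 x y * u y t) ∧
        -d2t = -ε2 * d2x + c1 * (∫ y in (0:ℝ)..1, P1i x y * u y t)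
          + ∫ y in (0:ℝ)..1, Q2 x y * v y t) ∧
    (∀ t ∈ Icc (0:ℝ) T,
      (∫ y in (0:ℝ)..1, P1i 1 y * u y t) = 0 ∧
      (∫ y in (0:ℝ)..1, P2i 0 y * v y t)
        = q * (ε1 / ε2) * ∫ y in (0:ℝ)..1, P1i 0 y * u y t) := by
  have h01 : uIcc (0:ℝ) 1 = Icc 0 1 := uIcc_of_le zero_le_one
  have hint : ∀ {f g : ℝ → ℝ}, ContinuousOn f (Icc 0 1) → ContinuousOn g (Icc 0 1) →
      IntervalIntegrable (fun y => f y * g y) volume 0 1 := fun hf hg =>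
    ContinuousOn.intervalIntegrable (by rw [h01]; exact hf.mul hg)
  refine ⟨fun x hx t ht => ?_, fun t _ => ⟨?_, ?_⟩⟩
  · have cu := hu.2.1.uncurry_section_left ht
    have cv := hv.2.1.uncurry_section_left ht
    have cux := hu.2.2.1.uncurry_section_left ht
    have cvx := hv.2.2.1.uncurry_section_left ht
    have cP1 := hP1i.2.1.uncurry_section_right hx
    have cP2 := hP2i.2.1.uncurry_section_right hx
    have cP1x := hP1i.2.2.1.uncurry_section_right hx
    have cP2x := hP2i.2.2.1.uncurry_section_right hx
    have cP1y := hP1i.2.2.2.uncurry_section_right hx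
    have cP2y := hP2i.2.2.2.uncurry_section_right hx
    have cP21 := hP2i.2.1.uncurry_section_right (right_mem_Icc.2 (zero_le_one (α := ℝ)))
    refine ⟨_, _, _, _, hu.hasDerivWithinAt_integral_mul cP1 ht,
      hP1i.hasDerivWithinAt_integral_mul cu hx, hv.hasDerivWithinAt_integral_mul cP2 ht,
      hP2i.hasDerivWithinAt_integral_mul cv hx, ?_, ?_⟩
    · have hdt : ∫ y in (0:ℝ)..1, P1i x y * ut y t
          = -ε1 * (∫ y in (0:ℝ)..1, P1i x y * ux y t) + c1 * ∫ y in (0:ℝ)..1, P1i x y * v y t := by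
        rw [← intervalIntegral.integral_const_mul, ← intervalIntegral.integral_const_mul,
          ← intervalIntegral.integral_add ((hint cP1 cux).const_mul _) ((hint cP1 cv).const_mul _)]
        refine intervalIntegral.integral_congr fun y hy => ?_
        rw [h01] at hy
        simp only [hpde1 y hy t ht]
        ring
      have hQ : ∫ y in (0:ℝ)..1, Q1 x y * u y t
          = -ε1 * (∫ y in (0:ℝ)..1, P1iy x y * u y t)
            - ε1 * ∫ y in (0:ℝ)..1, P1ix x y * u y t := by
        rw [← intervalIntegral.integral_const_mul, ← intervalIntegral.integral_const_mul,
          ← intervalIntegral.integral_sub ((hint cP1y cu).const_mul _)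
            ((hint cP1x cu).const_mul _)]
        refine intervalIntegral.integral_congr fun y hy => ?_
        rw [h01] at hy
        linear_combination u y t * hric1 x hx y hy
      have hcouple : c1 * (∫ y in (0:ℝ)..1, P1i x y * v y t)
          = -c2 * ∫ y in (0:ℝ)..1, P2i x y * v y t := by
        rw [← intervalIntegral.integral_const_mul, ← intervalIntegral.integral_const_mul]
        refine intervalIntegral.integral_congr fun y hy => ?_
        rw [h01] at hy
        linear_combination v y t * halg x hx y hy
      rw [hdt, hQ, hP1i.integral_mul_deriv hu hx ht, hbcP1y1 x hx, hbcP1y0 x hx]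
      linear_combination -hcouple
    · have hdt : ∫ y in (0:ℝ)..1, P2i x y * vt y t
          = ε2 * (∫ y in (0:ℝ)..1, P2i x y * vx y t) + c2 * ∫ y in (0:ℝ)..1, P2i x y * u y t := by
        rw [← intervalIntegral.integral_const_mul, ← intervalIntegral.integral_const_mul,
          ← intervalIntegral.integral_add ((hint cP2 cvx).const_mul _) ((hint cP2 cu).const_mul _)]
        refine intervalIntegral.integral_congr fun y hy => ?_
        rw [h01] at hy
        simp only [hpde2 y hy t ht]
        ring
      have hQ : ∫ y in (0:ℝ)..1, Q2 x y * v y t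
          = ε2 ^ 2 / R * P2i x 1 * (∫ y in (0:ℝ)..1, P2i 1 y * v y t)
            + ε2 * (∫ y in (0:ℝ)..1, P2iy x y * v y t)
            + ε2 * ∫ y in (0:ℝ)..1, P2ix x y * v y t := by
        rw [← intervalIntegral.integral_const_mul, ← intervalIntegral.integral_const_mul,
          ← intervalIntegral.integral_const_mul,
          ← intervalIntegral.integral_add ((hint cP21 cv).const_mul _)
            ((hint cP2y cv).const_mul _),
          ← intervalIntegral.integral_add (((hint cP21 cv).const_mul _).add
            ((hint cP2y cv).const_mul _)) ((hint cP2x cv).const_mul _)]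
        refine intervalIntegral.integral_congr fun y hy => ?_
        rw [h01] at hy
        linear_combination v y t * hric2 x hx y hy
      have hcouple : c1 * (∫ y in (0:ℝ)..1, P1i x y * u y t)
          = -c2 * ∫ y in (0:ℝ)..1, P2i x y * u y t := by
        rw [← intervalIntegral.integral_const_mul, ← intervalIntegral.integral_const_mul]
        refine intervalIntegral.integral_congr fun y hy => ?_
        rw [h01] at hy
        linear_combination u y t * halg x hx y hy
      rw [hdt, hQ, hP2i.integral_mul_deriv hv hx ht, hbcP2y0 x hx, hfeedback t ht]
      linear_combination -hcouple
  · rw [intervalIntegral.integral_congr (g := fun _ => (0:ℝ)), intervalIntegral.integral_zero]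
    intro y hy
    rw [h01] at hy
    simp [hbcP1x1 y hy]
  · rw [intervalIntegral.integral_congr (g := fun _ => (0:ℝ)),
      intervalIntegral.integral_congr (f := fun y => P1i 0 y * u y t) (g := fun _ => (0:ℝ))]
    · simp
    · intro y hy
      rw [h01] at hy
      simp [hbcP1x0 y hy]
    · intro y hy
      rw [h01] at hy
      simp [hbcP2x0 y hy]
end
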